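/- For every δ > 0 and every constant C > 0 there exists Q₀ such that for every prime q ≥ Q₀ the following two conditions cannot both hold: (i) #{1 ≤ n ≤ q : gcd(n,q) = 1, λ(n) ≠ χ_q(n)} ≤ C·q^{1-δ}; and (ii) λ(n + q) = λ(n) for every positive integer n ≤ q^{3/2} with gcd(n, q) = 1. -/

import Mathlib

open scoped BigOperators

/-- The Liouville function `λ(n) = (-1)^Ω(n)`. -/
def liouville (n : ℕ) : ℤ := (-1) ^ (ArithmeticFunction.cardFactors n)

theorem liouville_one : liouville 1 = 1 := by simp [liouville]

theorem liouville_mul {m n : ℕ} (hm : m ≠ 0) (hn : n ≠ 0) :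
    liouville (m * n) = liouville m * liouville n := by
  simp [liouville, ArithmeticFunction.cardFactors_mul hm hn, pow_add]

theorem liouville_prime {p : ℕ} (hp : p.Prime) : liouville p = -1 := by
  simp [liouville, ArithmeticFunction.cardFactors_apply_prime hp]

theorem liouville_mul_self (n : ℕ) : liouville n * liouville n = 1 := by
  rw [liouville, ← pow_add, ← two_mul, pow_mul]; simp

/-- Every prime `q > 5` has a smaller prime that is a quadratic residue modulo `q`. -/
theorem exists_prime_lt_isSquare {q : ℕ} [Fact q.Prime] (hq : 5 < q) :
    ∃ p : ℕ, p.Prime ∧ p < q ∧ IsSquare (p : ZMod q) := by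
  have hodd : q % 2 = 1 := (Fact.out : q.Prime).eq_two_or_odd.resolve_left (by omega)
  have hq2 : q ≠ 2 := by omega
  have h8 : q % 8 = 1 ∨ q % 8 = 7 ∨ q % 8 = 5 ∨ q % 8 = 3 := by omega
  rcases h8 with h | h | h | h
  · exact ⟨2, Nat.prime_two, by omega, by
      exact_mod_cast (ZMod.exists_sq_eq_two_iff hq2).2 (Or.inl h)⟩
  · exact ⟨2, Nat.prime_two, by omega, by
      exact_mod_cast (ZMod.exists_sq_eq_two_iff hq2).2 (Or.inr h)⟩
  · obtain ⟨p, hp, k, hk⟩ := Nat.exists_prime_and_dvd (n := (q - 1) / 4) (by omega)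
    have hpq : q = p * (4 * k) + 1 := by rw [mul_left_comm, ← hk]; omega
    have hple : p ≤ (q - 1) / 4 := Nat.le_of_dvd (by omega) ⟨k, hk⟩
    have hp2 : p ≠ 2 := by rintro rfl; omega
    have := Fact.mk hp
    refine ⟨p, hp, by omega, ?_⟩
    rw [ZMod.exists_sq_eq_prime_iff_of_mod_four_eq_one (by omega) hp2, hpq]
    simp
  · obtain ⟨p, hp, k, hk⟩ := Nat.exists_prime_and_dvd (n := (q + 1) / 4) (by omega)
    have hpq : q + 1 = p * (4 * k) := by rw [mul_left_comm, ← hk]; omega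
    have hple : p ≤ (q + 1) / 4 := Nat.le_of_dvd (by omega) ⟨k, hk⟩
    have hp2 : p ≠ 2 := by rintro rfl; omega
    have := Fact.mk hp
    have hp_odd := hp.eq_two_or_odd.resolve_left hp2
    have hneg : (q : ZMod p) = -1 := by
      have : ((q + 1 : ℕ) : ZMod p) = 0 := by rw [hpq]; simp
      push_cast at this
      exact eq_neg_of_add_eq_zero_left this
    have hp4 : p % 4 = 1 ∨ p % 4 = 3 := by omega
    refine ⟨p, hp, by omega, ?_⟩
    rcases hp4 with h4 | h4
    · rw [← ZMod.exists_sq_eq_prime_iff_of_mod_four_eq_one h4 hq2, hneg, ZMod.exists_sq_eq_neg_one_iff]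
      omega
    · rw [ZMod.exists_sq_eq_prime_iff_of_mod_four_eq_three (by omega) h4 (by omega), hneg,
        ZMod.exists_sq_eq_neg_one_iff]
      omega

/-- Thue's lemma: a nonzero residue modulo `q` is, up to sign, a quotient of two positive
integers of size at most `√q`. -/
theorem thue_lemma {q : ℕ} [Fact q.Prime] {x : ZMod q} (hx : x ≠ 0) :
    ∃ a b : ℕ, 0 < a ∧ 0 < b ∧ a ^ 2 ≤ q ∧ b ^ 2 ≤ q ∧
      ((b : ZMod q) * x = a ∨ (b : ZMod q) * x = -a) := by
  set s := Nat.sqrt q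
  have hs : s * s ≤ q := Nat.sqrt_le q
  have hs' : q < (s + 1) * (s + 1) := Nat.lt_succ_sqrt q
  have hq := (Fact.out : q.Prime).two_le
  have hsq : s < q := by nlinarith
  obtain ⟨⟨i, j⟩, hu, ⟨i', j'⟩, hv, hne, heq⟩ :=
    Finset.exists_ne_map_eq_of_card_lt_of_maps_to
      (s := Finset.range (s + 1) ×ˢ Finset.range (s + 1)) (t := (Finset.univ : Finset (ZMod q)))
      (f := fun u => (u.1 : ZMod q) - u.2 * x)
      (by simpa [ZMod.card] using hs') (fun _ _ => by simp)
  simp only [Finset.mem_product, Finset.mem_range] at hu hv heq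
  have inj : ∀ m n : ℕ, m < s + 1 → n < s + 1 → (m : ZMod q) = n → m = n := by
    intro m n hm hn h
    rw [ZMod.natCast_eq_natCast_iff', Nat.mod_eq_of_lt (by omega), Nat.mod_eq_of_lt (by omega)] at h
    exact h
  have hj : j ≠ j' := by
    rintro rfl
    exact hne (by rw [inj i i' hu.1 hv.1 (by linear_combination heq)])
  have hi : i ≠ i' := by
    rintro rfl
    have : ((j : ZMod q) - j') * x = 0 := by linear_combination -heq
    exact hj (inj j j' hu.2 hv.2 (sub_eq_zero.1 ((mul_eq_zero.1 this).resolve_right hx)))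
  have cast_natAbs : ∀ z : ℤ, ((z.natAbs : ℕ) : ZMod q) = z ∨ ((z.natAbs : ℕ) : ZMod q) = -z := by
    intro z
    rcases Int.natAbs_eq z with h | h
    · left; conv_rhs => rw [h]
      simp
    · right; conv_rhs => rw [h]
      simp
  refine ⟨((i : ℤ) - i').natAbs, ((j : ℤ) - j').natAbs, by omega, by omega, ?_, ?_, ?_⟩
  · exact (Nat.pow_le_pow_left (show _ ≤ s by omega) 2).trans (by rwa [sq])
  · exact (Nat.pow_le_pow_left (show _ ≤ s by omega) 2).trans (by rwa [sq])
  · have key : ((j : ZMod q) - j') * x = i - i' := by linear_combination -heq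
    rcases cast_natAbs ((i : ℤ) - i') with h | h <;> rcases cast_natAbs ((j : ℤ) - j') with h' | h' <;>
      rw [h, h'] <;> push_cast
    · left; linear_combination key
    · right; linear_combination -key
    · right; linear_combination key
    · left; linear_combination -key

/-- If `λ(n + q) = λ(n)` for `n` up to `q ^ (3 / 2)`, then `λ` is `q`-periodic in that range. -/
theorem liouville_eq_mod {q : ℕ} (hper : ∀ n : ℕ, 0 < n → n ^ 2 ≤ q ^ 3 → n.Coprime q →
    liouville (n + q) = liouville n) (hq : 1 < q) (n : ℕ) (hn : n ^ 2 ≤ q ^ 3)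
    (hcop : n.Coprime q) : liouville n = liouville (n % q) := by
  induction n using Nat.strong_induction_on with
  | _ n ih =>
    rcases lt_or_ge n q with h | h
    · rw [Nat.mod_eq_of_lt h]
    · obtain ⟨m, rfl⟩ := Nat.exists_eq_add_of_le' h
      have hc : m.Coprime q := by simpa using hcop
      have hm0 : 0 < m := by
        rcases Nat.eq_zero_or_pos m with rfl | h0
        · simp at hc; omega
        · exact h0
      have hm : m ^ 2 ≤ q ^ 3 := le_trans (Nat.pow_le_pow_left (by omega) 2) hn
      rw [hper m hm0 hm hc, Nat.add_mod_right]
      exact ih m (by omega) hm hc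

/-- The product of `λ` of the least nonnegative representative with the quadratic character. -/
noncomputable def liouvilleTwist (q : ℕ) [Fact q.Prime] (x : ZMod q) : ℤ :=
  liouville x.val * quadraticChar (ZMod q) x

theorem liouvilleTwist_one (q : ℕ) [Fact q.Prime] : liouvilleTwist q 1 = 1 := by
  have : Fact (1 < q) := ⟨(Fact.out : q.Prime).one_lt⟩
  simp [liouvilleTwist, ZMod.val_one, liouville_one]

/-- If `λ` is `q`-periodic up to `q ^ (3 / 2)`, its twist is multiplicative in products with a factor
of size at most `√q`. -/
theorem liouvilleTwist_natCast_mul {q : ℕ} [Fact q.Prime]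
    (hper : ∀ n : ℕ, 0 < n → n ^ 2 ≤ q ^ 3 → n.Coprime q → liouville (n + q) = liouville n)
    {a : ℕ} (ha : 0 < a) (haq : a ^ 2 ≤ q) {x : ZMod q} (hx : x ≠ 0) :
    liouvilleTwist q (a * x) = liouvilleTwist q a * liouvilleTwist q x := by
  have hq : q.Prime := Fact.out
  have hlt : a < q := by nlinarith [hq.two_le]
  have hx0 : x.val ≠ 0 := by rwa [Ne, ZMod.val_eq_zero]
  have hxq : x.val < q := ZMod.val_lt x
  have hcop : (a * x.val).Coprime q :=
    Nat.Coprime.mul_left (Nat.coprime_of_lt_prime ha.ne' hlt hq).symm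
      (Nat.coprime_of_lt_prime hx0 hxq hq).symm
  have hle : (a * x.val) ^ 2 ≤ q ^ 3 := by
    calc (a * x.val) ^ 2 = a ^ 2 * x.val ^ 2 := mul_pow _ _ _
      _ ≤ q * q ^ 2 := Nat.mul_le_mul haq (Nat.pow_le_pow_left hxq.le 2)
      _ = q ^ 3 := by ring
  have hval : ((a : ZMod q) * x).val = (a * x.val) % q := by
    rw [← ZMod.val_natCast]; simp
  rw [liouvilleTwist, liouvilleTwist, liouvilleTwist, hval,
    ← liouville_eq_mod hper hq.one_lt _ hle hcop, liouville_mul ha.ne' hx0, map_mul,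
    ZMod.val_natCast, Nat.mod_eq_of_lt hlt]
  ring

/-- If `λ` is `q`-periodic up to `q ^ (3 / 2)`, and every dilate of the set where `λ` agrees with the
quadratic character meets that set, then the two functions agree at every nonzero residue. -/
theorem liouvilleTwist_eq_one {q : ℕ} [Fact q.Prime]
    (hper : ∀ n : ℕ, 0 < n → n ^ 2 ≤ q ^ 3 → n.Coprime q → liouville (n + q) = liouville n)
    (hmeet : ∀ u : ZMod q, u ≠ 0 →
      ∃ x : ZMod q, x ≠ 0 ∧ liouvilleTwist q x = 1 ∧ liouvilleTwist q (u * x) = 1)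
    {x : ZMod q} (hx : x ≠ 0) : liouvilleTwist q x = 1 := by
  have hq : q.Prime := Fact.out
  have hsmall : ∀ a : ℕ, 0 < a → a ^ 2 ≤ q → liouvilleTwist q a = 1 := by
    intro a ha haq
    have ha0 : (a : ZMod q) ≠ 0 := by
      rw [Ne, ZMod.natCast_eq_zero_iff]
      exact Nat.not_dvd_of_pos_of_lt ha (by nlinarith [hq.two_le])
    obtain ⟨y, hy, hy1, hy2⟩ := hmeet a ha0
    rwa [liouvilleTwist_natCast_mul hper ha haq hy, hy1, mul_one] at hy2
  have hsign : ∀ y : ZMod q, y ≠ 0 →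
      (liouvilleTwist q y = 1 ∧ liouvilleTwist q (-y) = liouvilleTwist q (-1)) ∨
      (liouvilleTwist q y = liouvilleTwist q (-1) ∧ liouvilleTwist q (-y) = 1) := by
    intro y hy
    obtain ⟨a, b, ha, hb, haq, hbq, h⟩ := thue_lemma hy
    have h1 := liouvilleTwist_natCast_mul hper hb hbq hy
    have h2 := liouvilleTwist_natCast_mul hper hb hbq (neg_ne_zero.2 hy)
    have h3 := liouvilleTwist_natCast_mul hper ha haq (neg_ne_zero.2 (one_ne_zero (α := ZMod q)))
    rw [mul_neg_one, hsmall a ha haq, one_mul] at h3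
    rw [hsmall b hb hbq, one_mul] at h1 h2
    rw [mul_neg] at h2
    rcases h with h | h
    · left; rw [← h1, ← h2, h]; exact ⟨hsmall a ha haq, h3⟩
    · right; rw [← h1, ← h2, h, neg_neg]; exact ⟨h3, hsmall a ha haq⟩
  have hneg : liouvilleTwist q (-1) = 1 := by
    obtain ⟨y, hy, hy1, hy2⟩ := hmeet (-1) (neg_ne_zero.2 one_ne_zero)
    rw [neg_one_mul] at hy2
    rcases hsign y hy with h | h
    · rw [← h.2, hy2]
    · rw [← h.1, hy1]
  rcases hsign x hx with h | h
  · exact h.1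
  · rw [h.1, hneg]

/-- For a prime `q > 5`, the function `λ` differs from the quadratic character modulo `q` at some
nonzero residue. -/
theorem exists_liouvilleTwist_ne_one {q : ℕ} [Fact q.Prime] (hq : 5 < q) :
    ∃ x : ZMod q, x ≠ 0 ∧ liouvilleTwist q x ≠ 1 := by
  obtain ⟨p, hp, hpq, hsq⟩ := exists_prime_lt_isSquare hq
  have hp0 : (p : ZMod q) ≠ 0 := by
    rw [Ne, ZMod.natCast_eq_zero_iff]
    exact Nat.not_dvd_of_pos_of_lt hp.pos hpq
  refine ⟨p, hp0, ?_⟩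
  rw [liouvilleTwist, ZMod.val_natCast, Nat.mod_eq_of_lt hpq, liouville_prime hp,
    (quadraticChar_one_iff_isSquare hp0).2 hsq]
  decide

/-- A set of nonzero residues whose complement has fewer than `(q - 1) / 2` elements meets each of
its dilates. -/
theorem exists_mem_and_mul_mem {q : ℕ} [Fact q.Prime] (P : ZMod q → Prop) [DecidablePred P]
    (hcard : 2 * (Finset.univ.filter fun x : ZMod q => x ≠ 0 ∧ ¬ P x).card < q - 1)
    {u : ZMod q} (hu : u ≠ 0) : ∃ x : ZMod q, x ≠ 0 ∧ P x ∧ P (u * x) := by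
  by_contra! hcon
  set B := Finset.univ.filter fun x : ZMod q => x ≠ 0 ∧ ¬ P x
  have hsub : Finset.univ.erase (0 : ZMod q) ⊆ B ∪ B.image (u⁻¹ * ·) := by
    intro x hx
    have hx0 : x ≠ 0 := Finset.ne_of_mem_erase hx
    by_cases hP : P x
    · refine Finset.mem_union_right _ (Finset.mem_image.2 ⟨u * x, ?_, inv_mul_cancel_left₀ hu x⟩)
      simpa [B, hu, hx0] using hcon x hx0 hP
    · exact Finset.mem_union_left _ (by simp [B, hx0, hP])
  have h1 := Finset.card_le_card hsub
  rw [Finset.card_erase_of_mem (Finset.mem_univ _), Finset.card_univ, ZMod.card] at h1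
  have h2 := Finset.card_union_le B (B.image (u⁻¹ * ·))
  have h3 := Finset.card_image_le (s := B) (f := (u⁻¹ * ·))
  omega

/-- The residues where the twist is not `1` correspond to integers in `[1, q]` where `λ` differs
from the Jacobi symbol. -/
theorem card_liouvilleTwist_ne_one_le {q : ℕ} [Fact q.Prime] :
    (Finset.univ.filter fun x : ZMod q => x ≠ 0 ∧ ¬ liouvilleTwist q x = 1).card ≤
      ((Finset.Icc 1 q).filter
        fun n => n.Coprime q ∧ liouville n ≠ jacobiSym (n : ℤ) q).card := by
  refine Finset.card_le_card_of_injOn ZMod.val ?_ (ZMod.val_injective q).injOn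
  intro x hx
  obtain ⟨hx0, hx1⟩ := (Finset.mem_filter.1 hx).2
  have hv : x.val ≠ 0 := by rwa [Ne, ZMod.val_eq_zero]
  have hlt : x.val < q := ZMod.val_lt x
  refine Finset.mem_coe.2 (Finset.mem_filter.2 ⟨Finset.mem_Icc.2 ⟨by omega, hlt.le⟩,
    (Nat.coprime_of_lt_prime hv hlt Fact.out).symm, fun h => hx1 ?_⟩)
  rw [← jacobiSym.legendreSym.to_jacobiSym, legendreSym, Int.cast_natCast, ZMod.natCast_zmod_val] at h
  rw [liouvilleTwist, ← h, liouville_mul_self]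

open Filter in
theorem eventually_two_mul_rpow_lt {δ : ℝ} (hδ : 0 < δ) (C : ℝ) :
    ∀ᶠ q : ℕ in atTop, 2 * (C * (q : ℝ) ^ (1 - δ)) < q - 1 := by
  have h := ((tendsto_rpow_neg_atTop hδ).comp
    (tendsto_natCast_atTop_atTop (R := ℝ))).const_mul (2 * C)
  rw [mul_zero] at h
  filter_upwards [h.eventually_lt_const (show (0 : ℝ) < 1 / 2 by norm_num),
    eventually_gt_atTop 2] with q hq hq2
  have hq2' : (2 : ℝ) < q := by exact_mod_cast hq2
  have hpos : (0 : ℝ) < q := by linarith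
  simp only [Function.comp_apply] at hq
  rw [sub_eq_add_neg, Real.rpow_add hpos, Real.rpow_one]
  nlinarith

open Classical in
theorem liouville_does_not_pretend_to_be_legendre
    (δ : ℝ) (hδ : 0 < δ) (C : ℝ) (hC : 0 < C) :
    ∃ Q₀ : ℕ, ∀ q : ℕ, q.Prime → Q₀ ≤ q →
      ¬ ((((Finset.Icc 1 q).filter
            (fun n => n.Coprime q ∧ liouville n ≠ jacobiSym (n : ℤ) q)).card : ℝ)
            ≤ C * (q : ℝ) ^ ((1 : ℝ) - δ) ∧
         (∀ n : ℕ, 0 < n → (n : ℝ) ≤ (q : ℝ) ^ ((3 : ℝ) / 2) → n.Coprime q →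
            liouville (n + q) = liouville n)) := by
  obtain ⟨Q, hQ⟩ := Filter.eventually_atTop.1 (eventually_two_mul_rpow_lt hδ C)
  refine ⟨max Q 6, fun q hq hQq => ?_⟩
  rintro ⟨hcard, hper⟩
  have := Fact.mk hq
  have hbound := hQ q (le_of_max_le_left hQq)
  have hq6 : 6 ≤ q := le_of_max_le_right hQq
  have hper' : ∀ n : ℕ, 0 < n → n ^ 2 ≤ q ^ 3 → n.Coprime q → liouville (n + q) = liouville n := by
    refine fun n hn hle hcop => hper n hn ?_ hcop
    have hsq : ((q : ℝ) ^ ((3 : ℝ) / 2)) ^ 2 = (q : ℝ) ^ 3 := by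
      rw [← Real.rpow_natCast, ← Real.rpow_mul (Nat.cast_nonneg q), ← Real.rpow_natCast]
      norm_num
    refine le_of_sq_le_sq ?_ (by positivity)
    rw [hsq]
    exact_mod_cast hle
  obtain ⟨x, hx, hne⟩ := exists_liouvilleTwist_ne_one (q := q) (by omega)
  refine hne (liouvilleTwist_eq_one hper'
    (fun u hu => exists_mem_and_mul_mem (fun y => liouvilleTwist q y = 1) ?_ hu) hx)
  have hle : ((Finset.univ.filter
      fun y : ZMod q => y ≠ 0 ∧ ¬ liouvilleTwist q y = 1).card : ℝ) ≤ C * (q : ℝ) ^ (1 - δ) := by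
    refine le_trans (Nat.cast_le.2 card_liouvilleTwist_ne_one_le) ?_
    convert hcard
  have : 2 * ((Finset.univ.filter
      fun y : ZMod q => y ≠ 0 ∧ ¬ liouvilleTwist q y = 1).card : ℝ) < ((q - 1 : ℕ) : ℝ) := by
    rw [Nat.cast_sub hq.one_le, Nat.cast_one]
    linarith
  exact_mod_cast this
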